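/- Let 0 < p < 1 and let X have the BIU(p) distribution, with skewness τ(p) and kurtosis κ(p). Then the kurtosis-minus-squared-skewness parameter equals Δ(p) = κ(p) − τ(p)² = 9(4 + 32p − 80p² + 60p³ − 15p⁴) / (5p(4−3p)³). In particular Δ(1/2) = 189/125. -/

import Mathlib

open MeasureTheory ProbabilityTheory

/-- The law of `B * U` for independent `B ∼ Bernoulli(p)` and `U` of law `ν` is the mixture
of `δ₀` and `ν` with weights `1 - p` and `p`. -/
lemma map_bernoulli_mul {Ω : Type*} [MeasurableSpace Ω] {P : Measure Ω} [IsFiniteMeasure P]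
    {p : ℝ} {B U : Ω → ℝ} (hB : Measurable B) (hU : Measurable U) (hindep : IndepFun B U P)
    (hBlaw : Measure.map B P
      = ENNReal.ofReal (1 - p) • Measure.dirac 0 + ENNReal.ofReal p • Measure.dirac 1)
    {ν : Measure ℝ} [IsProbabilityMeasure ν] (hUlaw : Measure.map U P = ν) :
    Measure.map (fun ω => B ω * U ω) P
      = ENNReal.ofReal (1 - p) • Measure.dirac 0 + ENNReal.ofReal p • ν := by
  have hmul : Measurable fun x : ℝ × ℝ => x.1 * x.2 := measurable_fst.mul measurable_snd
  have hpair := (indepFun_iff_map_prod_eq_prod_map_map hB.aemeasurable hU.aemeasurable).1 hindep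
  have hcomp : Measure.map (fun ω => B ω * U ω) P
      = Measure.map (fun x : ℝ × ℝ => x.1 * x.2) (Measure.map (fun ω => (B ω, U ω)) P) := by
    rw [Measure.map_map hmul (hB.prodMk hU)]
    rfl
  rw [hcomp, hpair, hBlaw, hUlaw, Measure.add_prod, Measure.prod_smul_left,
    Measure.prod_smul_left, Measure.dirac_prod, Measure.dirac_prod, Measure.map_add _ _ hmul,
    Measure.map_smul, Measure.map_smul, Measure.map_map hmul measurable_prodMk_left,
    Measure.map_map hmul measurable_prodMk_left]
  congr 2
  · have h : ((fun x : ℝ × ℝ => x.1 * x.2) ∘ Prod.mk 0) = fun _ : ℝ => (0 : ℝ) := by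
      ext; simp
    rw [h, Measure.map_const, measure_univ, one_smul]
  · have h : ((fun x : ℝ × ℝ => x.1 * x.2) ∘ Prod.mk 1) = (id : ℝ → ℝ) := by
      ext; simp
    rw [h, Measure.map_id]

/-- The `n`-th moment about `c` of the boundary inflated uniform distribution. -/
lemma integral_sub_pow_of_map_eq_biu {Ω : Type*} [MeasurableSpace Ω] {P : Measure Ω}
    {p : ℝ} (hp0 : 0 ≤ p) (hp1 : p ≤ 1) {X : Ω → ℝ} (hX : Measurable X)
    (hXlaw : Measure.map X P = ENNReal.ofReal (1 - p) • Measure.dirac 0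
      + ENNReal.ofReal p • volume.restrict (Set.Icc (0 : ℝ) 1)) (c : ℝ) (n : ℕ) :
    ∫ ω, (X ω - c) ^ n ∂P
      = (1 - p) * (-c) ^ n + p * (((1 - c) ^ (n + 1) - (-c) ^ (n + 1)) / (n + 1)) := by
  have hf : Continuous fun x : ℝ => (x - c) ^ n := by fun_prop
  have hdirac : Integrable (fun x : ℝ => (x - c) ^ n)
      (ENNReal.ofReal (1 - p) • Measure.dirac 0) :=
    (integrable_dirac (by simp)).smul_measure ENNReal.ofReal_ne_top
  have hunif : Integrable (fun x : ℝ => (x - c) ^ n)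
      (ENNReal.ofReal p • volume.restrict (Set.Icc (0 : ℝ) 1)) :=
    (hf.continuousOn.integrableOn_compact isCompact_Icc).integrable.smul_measure
      ENNReal.ofReal_ne_top
  rw [← integral_map (f := fun x : ℝ => (x - c) ^ n) hX.aemeasurable hf.aestronglyMeasurable,
    hXlaw, integral_add_measure hdirac hunif, integral_smul_measure, integral_smul_measure,
    integral_dirac, integral_Icc_eq_integral_Ioc,
    ← intervalIntegral.integral_of_le zero_le_one,
    intervalIntegral.integral_comp_sub_right (fun x : ℝ => x ^ n), integral_pow,
    ENNReal.toReal_ofReal (sub_nonneg.2 hp1), ENNReal.toReal_ofReal hp0]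
  simp

/-- **Kurtosis minus squared skewness for the BIU(p) distribution.**
In particular its value at `p = 1/2` is `189/125`. -/
theorem biu_kurtosis_minus_squared_skewness
    {Ω : Type*} [MeasurableSpace Ω] (P : Measure Ω) [IsProbabilityMeasure P]
    (p : ℝ) (hp0 : 0 < p) (hp1 : p < 1)
    (B U : Ω → ℝ) (hB : Measurable B) (hU : Measurable U)
    (hindep : IndepFun B U P)
    (hBlaw : Measure.map B P
      = ENNReal.ofReal (1 - p) • Measure.dirac 0 + ENNReal.ofReal p • Measure.dirac 1)
    (hUlaw : Measure.map U P = volume.restrict (Set.Icc (0 : ℝ) 1))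
    (X : Ω → ℝ) (hX : X = fun ω => B ω * U ω)
    (τ κ : ℝ)
    (hτ : τ = (∫ ω, (X ω - ∫ ω', X ω' ∂P) ^ 3 ∂P)
        / (Real.sqrt (∫ ω', (X ω' - ∫ ω'', X ω'' ∂P) ^ 2 ∂P)) ^ 3)
    (hκ : κ = (∫ ω, (X ω - ∫ ω', X ω' ∂P) ^ 4 ∂P)
        / (∫ ω', (X ω' - ∫ ω'', X ω'' ∂P) ^ 2 ∂P) ^ 2) :
    κ - τ ^ 2
      = 9 * (4 + 32 * p - 80 * p ^ 2 + 60 * p ^ 3 - 15 * p ^ 4) / (5 * p * (4 - 3 * p) ^ 3)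
    ∧ (p = 1 / 2 → κ - τ ^ 2 = 189 / 125) := by
  have : IsProbabilityMeasure (volume.restrict (Set.Icc (0 : ℝ) 1)) := ⟨by simp⟩
  have hXlaw := map_bernoulli_mul hB hU hindep hBlaw hUlaw
  rw [← hX] at hXlaw
  have hXm : Measurable X := hX ▸ hB.mul hU
  have hmoment := integral_sub_pow_of_map_eq_biu hp0.le hp1.le hXm hXlaw
  have hmean : ∫ ω, X ω ∂P = p / 2 := by
    have h := hmoment 0 1
    norm_num at h
    linarith
  have hvar : ∫ ω, (X ω - p / 2) ^ 2 ∂P = p * (4 - 3 * p) / 12 := by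
    rw [hmoment]; push_cast; ring
  have hthird : ∫ ω, (X ω - p / 2) ^ 3 ∂P = p * (1 - p) ^ 2 / 4 := by
    rw [hmoment]; push_cast; ring
  have hfourth : ∫ ω, (X ω - p / 2) ^ 4 ∂P
      = p / 5 - p ^ 2 / 2 + p ^ 3 / 2 - 3 * p ^ 4 / 16 := by
    rw [hmoment]; push_cast; ring
  have hpos : 0 < 4 - 3 * p := by linarith
  have hsqrt : (Real.sqrt (p * (4 - 3 * p) / 12) ^ 3) ^ 2 = (p * (4 - 3 * p) / 12) ^ 3 := by
    rw [← pow_mul, mul_comm 3 2, pow_mul, Real.sq_sqrt (by positivity)]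
  have hΔ : κ - τ ^ 2 = 9 * (4 + 32 * p - 80 * p ^ 2 + 60 * p ^ 3 - 15 * p ^ 4)
      / (5 * p * (4 - 3 * p) ^ 3) := by
    rw [hτ, hκ, hmean, hvar, hthird, hfourth, div_pow _ (Real.sqrt _ ^ 3), hsqrt]
    have := hpos.ne'
    field_simp
    ring
  refine ⟨hΔ, fun h => ?_⟩
  rw [hΔ, h]
  norm_num
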